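/- Let Ω ⊂ ℝ^d be a bounded measurable set with positive finite Lebesgue measure and diameter at most 2R, and let K ≥ 2. Let μ_1,…,μ_K ∈ Ω be centers with fill distance h = sup_{x∈Ω} min_{1≤k≤K} ‖x−μ_k‖ > 0 and separation radius q = (1/2) min_{i≠j} ‖μ_i−μ_j‖ satisfying h ≤ ρ q for a constant ρ ≥ 1. Let the weights satisfy 0 < w₋ ≤ w_k ≤ w₊ and let Σ_k be symmetric positive definite d×d matrices with c_Σ h² I ⪯ Σ_k ⪯ C_Σ h² I for constants 0 < c_Σ ≤ C_Σ. If f : ℝ^d → ℝ is Lipschitz on Ω with constant L, then the normalized scaffold f_prim(x) = Σ_{k=1}^K ψ_k(x) f(μ_k) satisfies ‖f − f_prim‖_{L²(Ω)} ≤ C L K^{−1/d}, where C depends only on d, ρ, c_Σ, C_Σ, w₋, w₊, R, and the Lebesgue measure of Ω. -/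

import Mathlib

open MeasureTheory

/-- The anisotropic Gaussian basis function
`φₖ(x) = exp(−(1/2)(x−μₖ)ᵀ Σₖ⁻¹ (x−μₖ))`. -/
noncomputable def gaussBasis {d K : ℕ} (S : Fin K → Matrix (Fin d) (Fin d) ℝ)
    (μ : Fin K → EuclideanSpace ℝ (Fin d)) (k : Fin K)
    (x : EuclideanSpace ℝ (Fin d)) : ℝ :=
  Real.exp (-(1 / 2 : ℝ) * ∑ i, ∑ j, (x i - μ k i) * (S k)⁻¹ i j * (x j - μ k j))

/-- The normalized Shepard weight `ψₖ(x) = wₖ φₖ(x) / ∑ⱼ wⱼ φⱼ(x)`. -/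
noncomputable def shepardWeight {d K : ℕ} (S : Fin K → Matrix (Fin d) (Fin d) ℝ)
    (μ : Fin K → EuclideanSpace ℝ (Fin d)) (w : Fin K → ℝ) (k : Fin K)
    (x : EuclideanSpace ℝ (Fin d)) : ℝ :=
  w k * gaussBasis S μ k x / ∑ j, w j * gaussBasis S μ j x

open Matrix in
/-- If `α I ⪯ S` with `α > 0`, then `vᵀ S⁻¹ v ≤ ‖v‖² / α`. -/
lemma Matrix.PosDef.dotProduct_inv_mulVec_le {n : Type*} [Fintype n] [DecidableEq n]
    {S : Matrix n n ℝ} (hS : S.PosDef) {α : ℝ} (hα : 0 < α)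
    (h : (S - α • (1 : Matrix n n ℝ)).PosSemidef) (v : n → ℝ) :
    v ⬝ᵥ (S⁻¹ *ᵥ v) ≤ (v ⬝ᵥ v) / α := by
  have hdet : IsUnit S.det := (Matrix.isUnit_iff_isUnit_det S).1 hS.isUnit
  obtain ⟨u, hu⟩ : ∃ u, u = S⁻¹ *ᵥ v := ⟨_, rfl⟩
  have hSu : S *ᵥ u = v := by
    rw [hu, mulVec_mulVec, mul_nonsing_inv _ hdet, one_mulVec]
  have h1 : 0 ≤ u ⬝ᵥ v - α * (u ⬝ᵥ u) := by
    have := h.dotProduct_mulVec_nonneg u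
    simpa [sub_mulVec, smul_mulVec, hSu, dotProduct_sub, dotProduct_smul] using this
  have h2 : 0 ≤ (v - α • u) ⬝ᵥ (v - α • u) :=
    Finset.sum_nonneg fun i _ => mul_self_nonneg _
  have h3 : (v - α • u) ⬝ᵥ (v - α • u) = v ⬝ᵥ v - 2 * α * (v ⬝ᵥ u) + α ^ 2 * (u ⬝ᵥ u) := by
    simp only [sub_dotProduct, dotProduct_sub, dotProduct_smul, smul_dotProduct, smul_eq_mul]
    rw [dotProduct_comm u v]
    ring
  rw [← hu, le_div_iff₀ hα]
  rw [dotProduct_comm u v] at h1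
  nlinarith

open Matrix in
/-- If `S ⪯ β I` with `S` positive definite and `β > 0`, then `‖v‖² / β ≤ vᵀ S⁻¹ v`. -/
lemma Matrix.PosDef.le_dotProduct_inv_mulVec {n : Type*} [Fintype n] [DecidableEq n]
    {S : Matrix n n ℝ} (hS : S.PosDef) {β : ℝ} (hβ : 0 < β)
    (h : (β • (1 : Matrix n n ℝ) - S).PosSemidef) (v : n → ℝ) :
    (v ⬝ᵥ v) / β ≤ v ⬝ᵥ (S⁻¹ *ᵥ v) := by
  have hdet : IsUnit S.det := (Matrix.isUnit_iff_isUnit_det S).1 hS.isUnit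
  obtain ⟨u, hu⟩ : ∃ u, u = S⁻¹ *ᵥ v := ⟨_, rfl⟩
  have hSu : S *ᵥ u = v := by
    rw [hu, mulVec_mulVec, mul_nonsing_inv _ hdet, one_mulVec]
  have hsymm : u ⬝ᵥ (S *ᵥ v) = v ⬝ᵥ v := by
    have hT : Sᵀ = S := by simpa using hS.isHermitian.eq
    rw [dotProduct_mulVec, ← mulVec_transpose, hT, hSu]
  have h1 : 0 ≤ β * (v ⬝ᵥ v) - v ⬝ᵥ (S *ᵥ v) := by
    have := h.dotProduct_mulVec_nonneg v
    simpa [sub_mulVec, smul_mulVec, dotProduct_sub, dotProduct_smul] using this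
  have h2 : 0 ≤ (β • u - v) ⬝ᵥ (S *ᵥ (β • u - v)) := by
    simpa using hS.posSemidef.dotProduct_mulVec_nonneg (β • u - v)
  have h3 : (β • u - v) ⬝ᵥ (S *ᵥ (β • u - v))
      = β ^ 2 * (v ⬝ᵥ u) - 2 * β * (v ⬝ᵥ v) + v ⬝ᵥ (S *ᵥ v) := by
    simp only [mulVec_sub, mulVec_smul, sub_dotProduct, dotProduct_sub, dotProduct_smul,
      smul_dotProduct, smul_eq_mul, hSu, hsymm]
    rw [dotProduct_comm u v]
    ring
  rw [← hu, div_le_iff₀ hβ]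
  have h4 : 0 ≤ β * ((v ⬝ᵥ u) * β - v ⬝ᵥ v) := by nlinarith
  have := nonneg_of_mul_nonneg_right h4 hβ
  linarith

lemma gaussBasis_eq {d K : ℕ} (S : Fin K → Matrix (Fin d) (Fin d) ℝ)
    (μ : Fin K → EuclideanSpace ℝ (Fin d)) (k : Fin K) (x : EuclideanSpace ℝ (Fin d)) :
    gaussBasis S μ k x = Real.exp (-(1 / 2 : ℝ) *
      ((x - μ k).ofLp ⬝ᵥ ((S k)⁻¹.mulVec (x - μ k).ofLp))) := by
  simp [gaussBasis, dotProduct, Matrix.mulVec, Finset.mul_sum, mul_assoc]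

lemma gaussBasis_pos {d K : ℕ} (S : Fin K → Matrix (Fin d) (Fin d) ℝ)
    (μ : Fin K → EuclideanSpace ℝ (Fin d)) (k : Fin K) (x : EuclideanSpace ℝ (Fin d)) :
    0 < gaussBasis S μ k x :=
  Real.exp_pos _

lemma EuclideanSpace.dotProduct_self_eq_norm_sq {n : Type*} [Fintype n]
    (v : EuclideanSpace ℝ n) : v.ofLp ⬝ᵥ v.ofLp = ‖v‖ ^ 2 := by
  rw [EuclideanSpace.real_norm_sq_eq]
  simp [dotProduct, sq]

lemma gaussBasis_le {d K : ℕ} (S : Fin K → Matrix (Fin d) (Fin d) ℝ)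
    (μ : Fin K → EuclideanSpace ℝ (Fin d)) (k : Fin K) (x : EuclideanSpace ℝ (Fin d))
    (hS : (S k).PosDef) {β : ℝ} (hβ : 0 < β)
    (h : (β • (1 : Matrix (Fin d) (Fin d) ℝ) - S k).PosSemidef) :
    gaussBasis S μ k x ≤ Real.exp (-(1 / 2 : ℝ) * (‖x - μ k‖ ^ 2 / β)) := by
  have := hS.le_dotProduct_inv_mulVec hβ h (x - μ k).ofLp
  rw [EuclideanSpace.dotProduct_self_eq_norm_sq] at this
  rw [gaussBasis_eq, Real.exp_le_exp]
  linarith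

lemma le_gaussBasis {d K : ℕ} (S : Fin K → Matrix (Fin d) (Fin d) ℝ)
    (μ : Fin K → EuclideanSpace ℝ (Fin d)) (k : Fin K) (x : EuclideanSpace ℝ (Fin d))
    (hS : (S k).PosDef) {α : ℝ} (hα : 0 < α)
    (h : (S k - α • (1 : Matrix (Fin d) (Fin d) ℝ)).PosSemidef) :
    Real.exp (-(1 / 2 : ℝ) * (‖x - μ k‖ ^ 2 / α)) ≤ gaussBasis S μ k x := by
  have := hS.dotProduct_inv_mulVec_le hα h (x - μ k).ofLp
  rw [EuclideanSpace.dotProduct_self_eq_norm_sq] at this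
  rw [gaussBasis_eq, Real.exp_le_exp]
  linarith

/-- Gaussian decay dominates any polynomial decay. -/
lemma mul_exp_neg_sq_le (n : ℕ) {C t : ℝ} (hC : 0 < C) (ht : 0 ≤ t) :
    t * Real.exp (-(1 / 2) * (t ^ 2 / C)) ≤
      ((n + 1).factorial * Real.exp (1 + C / 2)) * ((1 + t) ^ n)⁻¹ := by
  have h1 : (1 + t) ^ (n + 1) ≤ (n + 1).factorial * Real.exp (1 + t) := by
    have := Real.pow_div_factorial_le_exp (1 + t) (by linarith) (n + 1)
    rwa [div_le_iff₀ (by positivity), mul_comm] at this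
  have h2 : Real.exp (1 + t) * Real.exp (-(1 / 2) * (t ^ 2 / C)) ≤ Real.exp (1 + C / 2) := by
    rw [← Real.exp_add, Real.exp_le_exp]
    have : t ^ 2 / C - 2 * t + C = (t - C) ^ 2 / C := by field_simp; ring
    have : 0 ≤ (t - C) ^ 2 / C := by positivity
    linarith
  rw [← div_eq_mul_inv, le_div_iff₀ (by positivity)]
  set e := Real.exp (-(1 / 2) * (t ^ 2 / C)) with he
  have he0 : 0 < e := Real.exp_pos _
  calc t * e * (1 + t) ^ n ≤ (1 + t) * e * (1 + t) ^ n := by gcongr; linarith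
    _ = (1 + t) ^ (n + 1) * e := by ring
    _ ≤ ((n + 1).factorial * Real.exp (1 + t)) * e := by gcongr
    _ = (n + 1).factorial * (Real.exp (1 + t) * e) := by ring
    _ ≤ _ := by gcongr

lemma pairwise_disjoint_ball_of_separated {X ι : Type*} [PseudoMetricSpace X] {z : ι → X} {δ : ℝ}
    (hz : ∀ i j, i ≠ j → 2 * δ ≤ dist (z i) (z j)) :
    Pairwise (Function.onFun Disjoint fun i => Metric.ball (z i) δ) := fun i j hij =>
  Metric.ball_disjoint_ball (by linarith [hz i j hij])

/-- Packing bound: separated points in a ball. -/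
lemma card_mul_pow_le_of_separated {d K : ℕ} {z : Fin K → EuclideanSpace ℝ (Fin d)}
    {δ r : ℝ} (hδ : 0 < δ) (hr : 0 ≤ r) (x : EuclideanSpace ℝ (Fin d))
    (hz : ∀ i j, i ≠ j → 2 * δ ≤ dist (z i) (z j)) (hzr : ∀ i, dist (z i) x ≤ r) :
    K * δ ^ d ≤ (r + δ) ^ d := by
  have hsub : (⋃ i, Metric.ball (z i) δ) ⊆ Metric.ball x (r + δ) :=
    Set.iUnion_subset fun i => Metric.ball_subset_ball' (by linarith [hzr i])
  have h := measure_mono (μ := volume) hsub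
  rw [measure_iUnion (pairwise_disjoint_ball_of_separated hz) fun i => measurableSet_ball] at h
  simp only [tsum_fintype, Measure.addHaar_ball_of_pos _ _ hδ,
    Measure.addHaar_ball_of_pos _ _ (by linarith : 0 < r + δ), Finset.sum_const, Finset.card_univ,
    Fintype.card_fin, finrank_euclideanSpace, nsmul_eq_mul] at h
  rw [← mul_assoc, ENNReal.mul_le_mul_iff_left (Metric.measure_ball_pos _ _ one_pos).ne'
    measure_ball_lt_top.ne, ← ENNReal.ofReal_natCast, ← ENNReal.ofReal_mul (by positivity),
    ENNReal.ofReal_le_ofReal_iff (by positivity)] at h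
  exact h

/-- Sums of a polynomially decaying function over separated points are uniformly bounded. -/
lemma exists_sum_inv_one_add_norm_pow_le (d : ℕ) {δ : ℝ} (hδ : 0 < δ) (hδ1 : δ ≤ 1) :
    ∃ B : ℝ, 0 ≤ B ∧ ∀ (K : ℕ) (z : Fin K → EuclideanSpace ℝ (Fin d)),
      (∀ i j, i ≠ j → 2 * δ ≤ dist (z i) (z j)) →
      ∑ k, ((1 + ‖z k‖) ^ (d + 1))⁻¹ ≤ B := by
  set g : EuclideanSpace ℝ (Fin d) → ℝ := fun y => ((1 + ‖y‖) ^ (d + 1))⁻¹ with hg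
  have hg0 : ∀ y, 0 ≤ g y := fun y => by positivity
  have hgi : Integrable g := by
    have := integrable_one_add_norm (E := EuclideanSpace ℝ (Fin d)) (μ := volume)
      (r := ((d + 1 : ℕ) : ℝ)) (by simp)
    refine this.congr (Filter.Eventually.of_forall fun y => ?_)
    simp only [hg]
    rw [Real.rpow_neg (by positivity), Real.rpow_natCast]
  set b : ℝ := volume.real (Metric.ball (0 : EuclideanSpace ℝ (Fin d)) δ) with hb
  have hb0 : 0 < b :=
    ENNReal.toReal_pos (Metric.measure_ball_pos _ _ hδ).ne' measure_ball_lt_top.ne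
  refine ⟨2 ^ (d + 1) * (∫ y, g y) / b, ?_, fun K z hz => ?_⟩
  · have : 0 ≤ ∫ y, g y := integral_nonneg hg0
    positivity
  rw [le_div_iff₀ hb0, Finset.sum_mul]
  have hk : ∀ k, ((1 + ‖z k‖) ^ (d + 1))⁻¹ * b ≤
      2 ^ (d + 1) * ∫ y in Metric.ball (z k) δ, g y := by
    intro k
    have hbk : volume.real (Metric.ball (z k) δ) = b := by
      simp only [hb, Measure.real, Measure.addHaar_ball_center]
    rw [← integral_const_mul, ← hbk, mul_comm, ← smul_eq_mul, ← setIntegral_const]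
    refine setIntegral_mono_on (integrableOn_const measure_ball_lt_top.ne)
      (hgi.const_mul _).integrableOn measurableSet_ball fun y hy => ?_
    have h1 : ‖y‖ ≤ ‖z k‖ + δ := by
      have := norm_sub_norm_le y (z k)
      rw [Metric.mem_ball, dist_eq_norm] at hy
      linarith
    have h2 : 1 + ‖y‖ ≤ 2 * (1 + ‖z k‖) := by linarith [norm_nonneg (z k)]
    have h3 : (1 + ‖y‖) ^ (d + 1) ≤ 2 ^ (d + 1) * (1 + ‖z k‖) ^ (d + 1) := by
      rw [← mul_pow]; gcongr
    simp only [hg]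
    rw [← div_eq_mul_inv, le_div_iff₀ (by positivity), inv_mul_le_iff₀ (by positivity)]
    linarith
  calc ∑ k, ((1 + ‖z k‖) ^ (d + 1))⁻¹ * b
      ≤ ∑ k, 2 ^ (d + 1) * ∫ y in Metric.ball (z k) δ, g y := Finset.sum_le_sum fun k _ => hk k
    _ = 2 ^ (d + 1) * ∫ y in ⋃ k, Metric.ball (z k) δ, g y := by
      rw [← Finset.mul_sum, integral_iUnion_fintype (fun _ => measurableSet_ball)
        (pairwise_disjoint_ball_of_separated hz) fun _ => hgi.integrableOn]
    _ ≤ 2 ^ (d + 1) * ∫ y, g y := by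
      exact mul_le_mul_of_nonneg_left
        (setIntegral_le_integral hgi (Filter.Eventually.of_forall hg0)) (by positivity)

lemma exists_norm_sub_le_fillDistance {d K : ℕ} [NeZero K] {Ω : Set (EuclideanSpace ℝ (Fin d))}
    (hΩ : Bornology.IsBounded Ω) {μ : Fin K → EuclideanSpace ℝ (Fin d)} (hμ : ∀ k, μ k ∈ Ω)
    {x : EuclideanSpace ℝ (Fin d)} (hx : x ∈ Ω) :
    ∃ k, ‖x - μ k‖ ≤ ⨆ x : Ω, ⨅ k, ‖(x : EuclideanSpace ℝ (Fin d)) - μ k‖ := by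
  obtain ⟨k, hk⟩ := exists_eq_ciInf_of_finite (f := fun k => ‖x - μ k‖)
  refine ⟨k, hk.le.trans ?_⟩
  refine le_ciSup (f := fun x : Ω => ⨅ k, ‖(x : EuclideanSpace ℝ (Fin d)) - μ k‖) ?_ ⟨x, hx⟩
  refine ⟨Metric.diam Ω, ?_⟩
  rintro _ ⟨y, rfl⟩
  refine (ciInf_le (Set.finite_range _).bddBelow (0 : Fin K)).trans ?_
  rw [← dist_eq_norm]
  exact Metric.dist_le_diam_of_mem hΩ y.2 (hμ 0)

lemma sum_shepardWeight {d K : ℕ} [NeZero K] (S : Fin K → Matrix (Fin d) (Fin d) ℝ)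
    (μ : Fin K → EuclideanSpace ℝ (Fin d)) {w : Fin K → ℝ} (hw : ∀ k, 0 < w k)
    (x : EuclideanSpace ℝ (Fin d)) : ∑ k, shepardWeight S μ w k x = 1 := by
  have : 0 < ∑ j, w j * gaussBasis S μ j x :=
    Finset.sum_pos (fun j _ => mul_pos (hw j) (gaussBasis_pos S μ j x)) Finset.univ_nonempty
  simp only [shepardWeight]
  rw [← Finset.sum_div, div_self this.ne']

lemma shepardWeight_nonneg {d K : ℕ} (S : Fin K → Matrix (Fin d) (Fin d) ℝ)
    (μ : Fin K → EuclideanSpace ℝ (Fin d)) {w : Fin K → ℝ} (hw : ∀ k, 0 < w k) (k : Fin K)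
    (x : EuclideanSpace ℝ (Fin d)) : 0 ≤ shepardWeight S μ w k x :=
  div_nonneg (mul_pos (hw k) (gaussBasis_pos S μ k x)).le
    (Finset.sum_nonneg fun j _ => (mul_pos (hw j) (gaussBasis_pos S μ j x)).le)

/-- The first absolute moment of the Shepard weights is of order `h`. -/
lemma exists_sum_shepardWeight_mul_norm_le (d : ℕ) {ρ cSig CSig wlo whi : ℝ} (hρ : 1 ≤ ρ)
    (hcSig : 0 < cSig) (hcC : cSig ≤ CSig) (hwlo : 0 < wlo) (hw : wlo ≤ whi) :
    ∃ M : ℝ, 0 ≤ M ∧ ∀ (K : ℕ) (μ : Fin K → EuclideanSpace ℝ (Fin d)) (h : ℝ), 0 < h →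
      (∀ i j, i ≠ j → 2 * (h / ρ) ≤ ‖μ i - μ j‖) →
      ∀ (w : Fin K → ℝ) (S : Fin K → Matrix (Fin d) (Fin d) ℝ),
        (∀ k, wlo ≤ w k ∧ w k ≤ whi) →
        (∀ k, (S k).PosDef) →
        (∀ k, (S k - (cSig * h ^ 2) • 1).PosSemidef ∧
              ((CSig * h ^ 2) • 1 - S k).PosSemidef) →
        ∀ x, (∃ k, ‖x - μ k‖ ≤ h) →
          ∑ k, shepardWeight S μ w k x * ‖x - μ k‖ ≤ M * h := by
  have hρ0 : 0 < ρ := by linarith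
  have hC : 0 < CSig := by linarith
  have hwhi : 0 < whi := by linarith
  obtain ⟨B, hB0, hB⟩ := exists_sum_inv_one_add_norm_pow_le d (δ := 1 / ρ) (by positivity)
    (by rw [div_le_one hρ0]; exact hρ)
  set A : ℝ := (d + 1 + 1).factorial * Real.exp (1 + CSig / 2) with hA
  have hA0 : 0 < A := by positivity
  set D : ℝ := wlo * Real.exp (-(1 / 2) * (1 / cSig)) with hD
  have hD0 : 0 < D := by positivity
  refine ⟨whi * (A * B) / D, by positivity, ?_⟩
  intro K μ h hh hsep w S hwk hS hSb x ⟨k₀, hk₀⟩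
  have hden : D ≤ ∑ j, w j * gaussBasis S μ j x := by
    refine le_trans ?_ (Finset.single_le_sum (f := fun j => w j * gaussBasis S μ j x)
      (fun j _ => mul_nonneg (hwlo.le.trans (hwk j).1) (gaussBasis_pos S μ j x).le)
      (Finset.mem_univ k₀))
    refine mul_le_mul (hwk k₀).1 (le_trans ?_ (le_gaussBasis S μ k₀ x (hS k₀) (by positivity)
      (hSb k₀).1)) (Real.exp_pos _).le (hwlo.le.trans (hwk k₀).1)
    rw [Real.exp_le_exp]
    have : ‖x - μ k₀‖ ^ 2 / (cSig * h ^ 2) ≤ 1 / cSig := by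
      rw [div_le_div_iff₀ (by positivity) hcSig]
      have : ‖x - μ k₀‖ ^ 2 ≤ h ^ 2 := by gcongr
      nlinarith
    linarith
  have hterm : ∀ k, gaussBasis S μ k x * ‖x - μ k‖ ≤
      A * h * ((1 + ‖h⁻¹ • (x - μ k)‖) ^ (d + 1))⁻¹ := by
    intro k
    have hn : ‖h⁻¹ • (x - μ k)‖ = ‖x - μ k‖ / h := by
      rw [norm_smul, norm_inv, Real.norm_of_nonneg hh.le, inv_mul_eq_div]
    have h1 := gaussBasis_le S μ k x (hS k) (by positivity) (hSb k).2
    have h2 := mul_exp_neg_sq_le (d + 1) hC (t := ‖x - μ k‖ / h) (by positivity)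
    rw [hn]
    have h3 : ‖x - μ k‖ ^ 2 / (CSig * h ^ 2) = (‖x - μ k‖ / h) ^ 2 / CSig := by
      field_simp
    rw [h3] at h1
    calc gaussBasis S μ k x * ‖x - μ k‖
        ≤ Real.exp (-(1 / 2) * ((‖x - μ k‖ / h) ^ 2 / CSig)) * ‖x - μ k‖ := by gcongr
      _ = h * (‖x - μ k‖ / h * Real.exp (-(1 / 2) * ((‖x - μ k‖ / h) ^ 2 / CSig))) := by
        field_simp
      _ ≤ h * (A * ((1 + ‖x - μ k‖ / h) ^ (d + 1))⁻¹) := by gcongr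
      _ = _ := by ring
  have hsum := hB K (fun k => h⁻¹ • (x - μ k)) fun i j hij => by
    rw [dist_eq_norm, ← smul_sub, norm_smul, norm_inv, Real.norm_of_nonneg hh.le,
      sub_sub_sub_cancel_left, inv_mul_eq_div, le_div_iff₀ hh, norm_sub_rev]
    calc 2 * (1 / ρ) * h = 2 * (h / ρ) := by ring
      _ ≤ _ := hsep i j hij
  have hnum : ∑ k, w k * gaussBasis S μ k x * ‖x - μ k‖ ≤ whi * (A * B) * h := by
    calc ∑ k, w k * gaussBasis S μ k x * ‖x - μ k‖
        ≤ ∑ k, whi * (A * h * ((1 + ‖h⁻¹ • (x - μ k)‖) ^ (d + 1))⁻¹) := by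
          refine Finset.sum_le_sum fun k _ => ?_
          rw [mul_assoc]
          exact mul_le_mul (hwk k).2 (hterm k)
            (mul_nonneg (gaussBasis_pos S μ k x).le (norm_nonneg _)) hwhi.le
      _ = whi * (A * h * ∑ k, ((1 + ‖h⁻¹ • (x - μ k)‖) ^ (d + 1))⁻¹) := by
          simp only [Finset.mul_sum]
      _ ≤ whi * (A * h * B) := by gcongr
      _ = _ := by ring
  calc ∑ k, shepardWeight S μ w k x * ‖x - μ k‖
      = (∑ k, w k * gaussBasis S μ k x * ‖x - μ k‖) / ∑ j, w j * gaussBasis S μ j x := by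
        simp only [shepardWeight, Finset.sum_div]
        exact Finset.sum_congr rfl fun k _ => by ring
    _ ≤ (whi * (A * B) * h) / D := by gcongr
    _ = _ := by ring

/-- **first-order `L²` rate of the normalized scaffold.** For a bounded
measurable `Ω` of positive finite measure `V` and diameter at most `2R`, quasi-uniform
centers, bounded weights and covariances comparable to `h²I`, and `f` Lipschitz on `Ω`
with constant `L`, the normalized scaffold `f_prim = ∑ₖ ψₖ f(μₖ)` satisfies
`‖f − f_prim‖_{L²(Ω)} ≤ C L K^{−1/d}`, where `C` depends only on
`d, ρ, c_Σ, C_Σ, w₋, w₊, R` and the measure `V` of `Ω`. -/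
theorem shepard_L2_rate
    (d : ℕ) (hd : 0 < d) (ρ cSig CSig wlo whi R : ℝ) (V : ENNReal)
    (hρ : 1 ≤ ρ) (hcSig : 0 < cSig) (hcC : cSig ≤ CSig)
    (hwlo : 0 < wlo) (hw : wlo ≤ whi) (hV0 : 0 < V) (hVtop : V ≠ ⊤) :
    ∃ C : ℝ, ∀ (Ω : Set (EuclideanSpace ℝ (Fin d))),
      MeasurableSet Ω → Bornology.IsBounded Ω → volume Ω = V → Metric.diam Ω ≤ 2 * R →
      ∀ (K : ℕ), 2 ≤ K →
      ∀ (μ : Fin K → EuclideanSpace ℝ (Fin d)) (h q : ℝ),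
      (∀ k, μ k ∈ Ω) →
      h = ⨆ x : Ω, ⨅ k, ‖(x : EuclideanSpace ℝ (Fin d)) - μ k‖ →
      0 < h →
      q = (1 / 2) * ⨅ p : {p : Fin K × Fin K // p.1 ≠ p.2}, ‖μ p.val.1 - μ p.val.2‖ →
      h ≤ ρ * q →
      ∀ (w : Fin K → ℝ) (S : Fin K → Matrix (Fin d) (Fin d) ℝ),
        (∀ k, wlo ≤ w k ∧ w k ≤ whi) →
        (∀ k, (S k).PosDef) →
        (∀ k, (S k - (cSig * h ^ 2) • 1).PosSemidef ∧
              ((CSig * h ^ 2) • 1 - S k).PosSemidef) →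
        ∀ (f : EuclideanSpace ℝ (Fin d) → ℝ) (L : ℝ),
          (∀ x ∈ Ω, ∀ y ∈ Ω, |f x - f y| ≤ L * ‖x - y‖) →
          Real.sqrt (∫ x in Ω, (f x - ∑ k, shepardWeight S μ w k x * f (μ k)) ^ 2)
            ≤ C * L * (K : ℝ) ^ (-(1 : ℝ) / d) := by
  obtain ⟨M, hM0, hM⟩ := exists_sum_shepardWeight_mul_norm_le d hρ hcSig hcC hwlo hw
  refine ⟨M * ρ * (3 * R) * Real.sqrt V.toReal, ?_⟩
  intro Ω _ hΩb hΩV hdiam K hK μ h q hμ hh hh0 hq hhq w S hwk hS hSb f L hf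
  have hρ0 : 0 < ρ := by linarith
  have hKpos : 0 < K := by omega
  have : NeZero K := ⟨hKpos.ne'⟩
  have hq0 : 0 < q := pos_of_mul_pos_right (hh0.trans_le hhq) hρ0.le
  have hsep : ∀ i j, i ≠ j → 2 * q ≤ ‖μ i - μ j‖ := fun i j hij => by
    have := ciInf_le (f := fun p : {p : Fin K × Fin K // p.1 ≠ p.2} => ‖μ p.val.1 - μ p.val.2‖)
      (Set.finite_range _).bddBelow ⟨(i, j), hij⟩
    simp only at this
    linarith
  have hdist : ∀ i j, dist (μ i) (μ j) ≤ 2 * R := fun i j =>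
    (Metric.dist_le_diam_of_mem hΩb (hμ i) (hμ j)).trans hdiam
  obtain ⟨i₀, i₁, hi⟩ : ∃ i j : Fin K, i ≠ j :=
    ⟨⟨0, hKpos⟩, ⟨1, by omega⟩, by simp [Fin.ext_iff]⟩
  have hqR : q ≤ R := by
    have h1 := hsep i₀ i₁ hi
    have h2 := hdist i₀ i₁
    rw [dist_eq_norm] at h2
    linarith
  have hR : 0 < R := by linarith
  have hL : 0 ≤ L := by
    have h1 := (abs_nonneg _).trans (hf _ (hμ i₀) _ (hμ i₁))
    exact nonneg_of_mul_nonneg_left h1 (by linarith [hsep i₀ i₁ hi])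
  have hqK : q ≤ 3 * R * (K : ℝ) ^ (-(1 : ℝ) / d) := by
    have hd' : (d : ℝ) ≠ 0 := by exact_mod_cast hd.ne'
    have hpack : (K : ℝ) * q ^ d ≤ (3 * R) ^ d :=
      (card_mul_pow_le_of_separated hq0 (by linarith) (μ i₀)
        (fun i j hij => by rw [dist_eq_norm]; exact hsep i j hij) fun i => hdist i i₀).trans
        (by gcongr; linarith)
    have hKd : ((K : ℝ) ^ (-(1 : ℝ) / d)) ^ d = (K : ℝ)⁻¹ := by
      rw [← Real.rpow_natCast, ← Real.rpow_mul (by positivity), div_mul_cancel₀ _ hd',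
        Real.rpow_neg_one]
    refine le_of_pow_le_pow_left₀ hd.ne' (by positivity) ?_
    rw [mul_pow, hKd, ← div_eq_mul_inv, le_div_iff₀ (by positivity)]
    linarith
  have hwpos : ∀ k, 0 < w k := fun k => hwlo.trans_le (hwk k).1
  have hpt : ∀ x ∈ Ω, |f x - ∑ k, shepardWeight S μ w k x * f (μ k)| ≤ L * (M * h) := by
    intro x hx
    have hmom := hM K μ h hh0 (fun i j hij => le_trans (by
      gcongr
      rw [div_le_iff₀ hρ0]
      linarith) (hsep i j hij)) w S hwk hS hSb x
      (by rw [hh]; exact exists_norm_sub_le_fillDistance hΩb hμ hx)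
    have heq : f x - ∑ k, shepardWeight S μ w k x * f (μ k)
        = ∑ k, shepardWeight S μ w k x * (f x - f (μ k)) := by
      simp only [mul_sub, Finset.sum_sub_distrib, ← Finset.sum_mul]
      rw [sum_shepardWeight S μ hwpos x, one_mul]
    rw [heq]
    calc |∑ k, shepardWeight S μ w k x * (f x - f (μ k))|
        ≤ ∑ k, |shepardWeight S μ w k x * (f x - f (μ k))| := Finset.abs_sum_le_sum_abs _ _
      _ ≤ ∑ k, L * (shepardWeight S μ w k x * ‖x - μ k‖) := by
        refine Finset.sum_le_sum fun k _ => ?_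
        have h0 := shepardWeight_nonneg S μ hwpos k x
        rw [abs_mul, abs_of_nonneg h0, mul_left_comm]
        exact mul_le_mul_of_nonneg_left (hf x hx _ (hμ k)) h0
      _ = L * ∑ k, shepardWeight S μ w k x * ‖x - μ k‖ := by rw [Finset.mul_sum]
      _ ≤ L * (M * h) := by gcongr
  have hint : ∫ x in Ω, (f x - ∑ k, shepardWeight S μ w k x * f (μ k)) ^ 2
      ≤ (L * (M * h)) ^ 2 * V.toReal := by
    have := norm_setIntegral_le_of_norm_le_const (μ := volume) (s := Ω)
      (f := fun x => (f x - ∑ k, shepardWeight S μ w k x * f (μ k)) ^ 2)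
      (C := (L * (M * h)) ^ 2) (by rw [hΩV]; exact hVtop.lt_top) fun x hx => by
        rw [norm_pow, Real.norm_eq_abs]
        gcongr
        exact hpt x hx
    rw [Measure.real, hΩV] at this
    exact (le_abs_self _).trans this
  calc Real.sqrt (∫ x in Ω, (f x - ∑ k, shepardWeight S μ w k x * f (μ k)) ^ 2)
      ≤ Real.sqrt ((L * (M * h)) ^ 2 * V.toReal) := Real.sqrt_le_sqrt hint
    _ = L * (M * h) * Real.sqrt V.toReal := by
      rw [Real.sqrt_mul (by positivity), Real.sqrt_sq (by positivity)]
    _ ≤ L * (M * (ρ * (3 * R * (K : ℝ) ^ (-(1 : ℝ) / d)))) * Real.sqrt V.toReal := by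
      gcongr
      exact hhq.trans (by gcongr)
    _ = _ := by ring
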